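/- arXiv:1705.08067 — 4 statements merged into one kernel-verified Lean document; each statement's English description precedes it below -/
import Mathlib

section
/- Let λ/μ be a skew partition (μ ⊆ λ), let d = ℓ(λ) be the length of λ (with μ extended by zeros to length d), and let w ≥ 1 and z_1,…,z_w be complex numbers. Set n = λ_1 + d, and define the strictly increasing d-tuples ξ = (λ_d + 1, λ_{d−1} + 2, …, λ_1 + d) and η = (μ_d + 1, μ_{d−1} + 2, …, μ_1 + d) with entries in {1,…,n}, and let ρ, σ be their complements in {1,…,n}. Let a be the Laurent polynomial with p = 0 and a_0-leading coefficient 1, i.e. a(t) = t^{−w} ∏_{j=1}^w (t − z_j), with coefficients a_k = (−1)^{−k} e_{−k}(z_1,…,z_w). Then s_{λ/μ}(z_1,…,z_w) = (−1)^{|λ|+|μ|} · det(T_n(a)_{ρ,σ}), where |λ| and |μ| are the weights (sums of parts) of λ and μ. -/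
open scoped BigOperators

/-- The `r`-th elementary symmetric polynomial in `w` variables, evaluated at `z`,
extended by `0` to negative integer indices (and automatically `0` for `r > w`). -/
noncomputable def eInt (w : ℕ) (z : Fin w → ℂ) (r : ℤ) : ℂ :=
  if 0 ≤ r then
    ∑ s ∈ Finset.powersetCard r.toNat (Finset.univ : Finset (Fin w)), ∏ i ∈ s, z i
  else 0

/-- The `r`-th complete homogeneous symmetric polynomial in `w` variables, evaluated at `z`,
extended by `0` to negative integer indices. -/
noncomputable def hInt (w : ℕ) (z : Fin w → ℂ) (r : ℤ) : ℂ :=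
  if 0 ≤ r then ∑ m : Sym (Fin w) r.toNat, (m.1.map z).prod else 0

/-- Skew Schur polynomial via the Jacobi–Trudi determinant
`s_{λ/μ} = det [h_{λ_j - μ_k - j + k}]_{j,k=1}^{ℓ}`,
where the parts are given as `1`-based integer sequences `lam`, `mu`. -/
noncomputable def skewSchur (w : ℕ) (z : Fin w → ℂ) (ℓ : ℕ) (lam mu : ℕ → ℤ) : ℂ :=
  Matrix.det (Matrix.of fun j k : Fin ℓ =>
    hInt w z (lam (j.1 + 1) - mu (k.1 + 1) - ((j.1 : ℤ) + 1) + ((k.1 : ℤ) + 1)))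

/-- Schur polynomial `s_λ`. -/
noncomputable def schur (w : ℕ) (z : Fin w → ℂ) (ℓ : ℕ) (lam : ℕ → ℤ) : ℂ :=
  skewSchur w z ℓ lam (fun _ => 0)

/-- Coefficients of the Laurent polynomial `a(t) = a_p t^(p-w) ∏_{j=1}^w (t - z_j)`,
namely `a_k = (-1)^(p-k) * a_p * e_{p-k}(z_1,…,z_w)`. -/
noncomputable def aCoeff (w p : ℕ) (ap : ℂ) (z : Fin w → ℂ) (k : ℤ) : ℂ :=
  (-1 : ℂ) ^ ((p : ℤ) - k) * ap * eInt w z ((p : ℤ) - k)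

/-- The `n × n` Toeplitz matrix `[a_{j-k}]_{j,k=1}^n` with coefficient sequence `a`. -/
noncomputable def toeplitz (n : ℕ) (a : ℤ → ℂ) : Matrix (Fin n) (Fin n) ℂ :=
  Matrix.of fun j k => a ((j.1 : ℤ) - (k.1 : ℤ))
/-- The generating function of the elementary symmetric polynomials, with alternating signs. -/
theorem mk_eInt_eq_prod (w : ℕ) (z : Fin w → ℂ) :
    (PowerSeries.mk fun k : ℕ => (-1 : ℂ) ^ k * eInt w z k)
      = ∏ i, (1 - PowerSeries.C (z i) * PowerSeries.X) := by
  ext k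
  have hprod : ∏ i, (1 - PowerSeries.C (z i) * PowerSeries.X)
      = ∑ s ∈ (Finset.univ : Finset (Fin w)).powerset,
          PowerSeries.C ((-1) ^ s.card * ∏ i ∈ s, z i) * PowerSeries.X ^ s.card := by
    simp only [sub_eq_add_neg]
    rw [Finset.prod_one_add]
    refine Finset.sum_congr rfl fun s _ => ?_
    rw [Finset.prod_neg, Finset.prod_mul_distrib, Finset.prod_const]
    simp [mul_assoc]
  rw [hprod, map_sum, PowerSeries.coeff_mk, eInt, if_pos (by positivity), Int.toNat_natCast,
    Finset.mul_sum]
  simp only [PowerSeries.coeff_C_mul, PowerSeries.coeff_X_pow, mul_ite, mul_one, mul_zero]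
  rw [← Finset.sum_filter, Finset.powersetCard_eq_filter]
  refine Finset.sum_congr (Finset.filter_congr fun _ _ => eq_comm) fun s hs => ?_
  rw [(Finset.mem_filter.1 hs).2]

/-- The generating function of the complete homogeneous symmetric polynomials. -/
theorem mk_hInt_eq_prod (w : ℕ) (z : Fin w → ℂ) :
    (PowerSeries.mk fun k : ℕ => hInt w z k) = ∏ i, PowerSeries.mk fun k => z i ^ k := by
  ext k
  rw [PowerSeries.coeff_prod, PowerSeries.coeff_mk, hInt, if_pos (by positivity),
    Int.toNat_natCast]
  simp only [PowerSeries.coeff_mk]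
  refine Finset.sum_bij (fun s _ => Multiset.toFinsupp s.1) ?_ ?_ ?_ ?_
  · intro s _
    refine Finset.mem_finsuppAntidiag.2 ⟨?_, Finset.subset_univ _⟩
    change ∑ i, Multiset.count i s.1 = k
    rw [Multiset.sum_count_eq_card fun _ _ => Finset.mem_univ _, s.2]
  · intro s _ t _ h
    exact Subtype.ext (Multiset.toFinsupp.injective h)
  · intro f hf
    refine ⟨⟨Finsupp.toMultiset f, ?_⟩, Finset.mem_univ _, ?_⟩
    · rw [Finset.mem_finsuppAntidiag] at hf
      rw [Finsupp.card_toMultiset, Finsupp.sum_fintype _ _ (fun _ => rfl)]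
      exact hf.1
    · simp
  · intro s _
    rw [Finset.prod_multiset_map_count]
    refine Finset.prod_subset (Finset.subset_univ _) fun i _ hi => ?_
    rw [Multiset.count_eq_zero_of_notMem (by simpa using hi), pow_zero]

theorem mk_pow_mul_one_sub {R : Type*} [CommRing R] (x : R) :
    (PowerSeries.mk fun k => x ^ k) * (1 - PowerSeries.C x * PowerSeries.X) = 1 := by
  ext (_ | k)
  · simp
  · rw [mul_sub, mul_one, ← mul_assoc, map_sub, PowerSeries.coeff_succ_mul_X,
      PowerSeries.coeff_mul_C]
    simp [pow_succ, PowerSeries.coeff_one]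

theorem mk_eInt_mul_mk_hInt (w : ℕ) (z : Fin w → ℂ) :
    (PowerSeries.mk fun k : ℕ => (-1 : ℂ) ^ k * eInt w z k)
      * (PowerSeries.mk fun k : ℕ => hInt w z k) = 1 := by
  rw [mk_eInt_eq_prod, mk_hInt_eq_prod, ← Finset.prod_mul_distrib]
  exact Finset.prod_eq_one fun i _ => by rw [mul_comm, mk_pow_mul_one_sub]

/-- The upper triangular Toeplitz matrix whose superdiagonals are the coefficients of `f`. -/
noncomputable def upperToeplitz {R : Type*} [CommRing R] (n : ℕ) (f : PowerSeries R) :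
    Matrix (Fin n) (Fin n) R :=
  Matrix.of fun j k => if j ≤ k then PowerSeries.coeff (k.1 - j.1) f else 0

theorem upperToeplitz_mul {R : Type*} [CommRing R] (n : ℕ) (f g : PowerSeries R) :
    upperToeplitz n f * upperToeplitz n g = upperToeplitz n (f * g) := by
  ext j k
  simp only [upperToeplitz, Matrix.mul_apply, Matrix.of_apply, ite_mul, zero_mul, mul_ite,
    mul_zero]
  simp only [← ite_and]
  rw [← Finset.sum_filter]
  split_ifs with h
  · rw [PowerSeries.coeff_mul]
    refine Finset.sum_bij (fun l _ => (l.1 - j.1, k.1 - l.1)) ?_ ?_ ?_ ?_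
    · intro l hl
      simp only [Finset.mem_filter, Finset.mem_univ, true_and, Fin.le_def] at hl
      rw [Finset.HasAntidiagonal.mem_antidiagonal]
      omega
    · intro l hl l' hl' he
      simp only [Finset.mem_filter, Finset.mem_univ, true_and, Fin.le_def, Prod.mk.injEq]
        at hl hl' he
      exact Fin.ext (by omega)
    · rintro ⟨a, b⟩ hab
      rw [Finset.HasAntidiagonal.mem_antidiagonal] at hab
      simp only [Fin.le_def] at h
      simp only at hab
      refine ⟨⟨j.1 + a, by omega⟩, ?_, ?_⟩
      · simp only [Finset.mem_filter, Finset.mem_univ, true_and, Fin.le_def]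
        omega
      · simp only [Prod.mk.injEq]
        omega
    · intro l _
      rfl
  · refine Finset.sum_eq_zero fun l hl => ?_
    simp only [Finset.mem_filter, Finset.mem_univ, true_and] at hl
    exact absurd (hl.2.trans hl.1) h

theorem upperToeplitz_one {R : Type*} [CommRing R] (n : ℕ) :
    upperToeplitz n (1 : PowerSeries R) = 1 := by
  ext j k
  simp only [upperToeplitz, Matrix.of_apply, PowerSeries.coeff_one, Matrix.one_apply, Fin.le_def,
    Fin.ext_iff, ← ite_and]
  congr 1
  rw [eq_iff_iff]
  omega

theorem det_upperToeplitz {R : Type*} [CommRing R] (n : ℕ) (f : PowerSeries R) :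
    (upperToeplitz n f).det = PowerSeries.coeff 0 f ^ n := by
  rw [Matrix.det_of_isUpperTriangular]
  · simp [upperToeplitz]
  · intro j k hjk
    exact if_neg (not_le.2 hjk)

/-- A permutation which is increasing on the first `d` and on the last `m` indices has as many
inversions as the total displacement of the first `d` indices. -/
theorem sign_of_strictMono_blocks {d m : ℕ} (π : Equiv.Perm (Fin (d + m)))
    (h₁ : StrictMono fun i : Fin d => π (Fin.castAdd m i))
    (h₂ : StrictMono fun j : Fin m => π (Fin.natAdd d j)) :
    Equiv.Perm.sign π = (-1) ^ ∑ i : Fin d, ((π (Fin.castAdd m i)).1 - i.1) := by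
  rw [Equiv.Perm.sign_eq_prod_prod_Ioi, Fin.prod_univ_add, ← Finset.prod_pow_eq_pow_sum]
  have hright : ∀ i : Fin m, ∏ j ∈ Finset.Ioi (Fin.natAdd d i),
      (if π (Fin.natAdd d i) < π j then (1 : ℤˣ) else -1) = 1 := by
    intro i
    refine Finset.prod_eq_one fun j hj => if_pos ?_
    rw [Finset.mem_Ioi] at hj
    induction j using Fin.addCases with
    | left j => exact absurd hj (by simp [Fin.lt_def]; omega)
    | right j => exact h₂ (by simpa using hj)
  rw [Finset.prod_congr rfl fun i _ => hright i, Finset.prod_const_one, mul_one]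
  refine Finset.prod_congr rfl fun i _ => ?_
  set a := Fin.castAdd m i with ha
  rw [Finset.prod_ite, Finset.prod_const_one, one_mul, Finset.prod_const]
  congr 1
  have hcount : (Finset.univ.filter fun j => π j < π a).card = (π a).1 := by
    rw [← Fin.card_Iio (π a)]
    refine Finset.card_bij (fun j _ => π j) (by simp) (fun _ _ _ _ h => π.injective h) ?_
    intro b hb
    exact ⟨π.symm b, by simpa using hb, by simp⟩
  have hsplit : (Finset.univ.filter fun j => π j < π a)
      = Finset.Iio a ∪ (Finset.Ioi a).filter fun j => ¬ π a < π j := by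
    ext j
    simp only [Finset.mem_filter, Finset.mem_univ, true_and, Finset.mem_union, Finset.mem_Iio,
      Finset.mem_Ioi, not_lt]
    constructor
    · intro h
      rcases lt_trichotomy j a with hlt | rfl | hgt
      · exact Or.inl hlt
      · exact absurd h (lt_irrefl _)
      · exact Or.inr ⟨hgt, h.le⟩
    · rintro (h | ⟨h, h'⟩)
      · induction j using Fin.addCases with
        | left j => exact h₁ (Fin.lt_def.2 h)
        | right j => exact absurd h (by simp [ha, Fin.lt_def]; omega)
      · exact lt_of_le_of_ne h' fun he => h.ne' (π.injective he)
  have hdisj : Disjoint (Finset.Iio a) ((Finset.Ioi a).filter fun j => ¬ π a < π j) :=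
    Finset.disjoint_left.2 fun j hj hj' => by
      simp only [Finset.mem_filter, Finset.mem_Ioi, Finset.mem_Iio] at hj hj'
      exact lt_asymm hj hj'.1
  rw [hsplit, Finset.card_union_of_disjoint hdisj, Fin.card_Iio] at hcount
  have hai : a.1 = i.1 := rfl
  omega

/-- Jacobi's identity for complementary minors, with the sign left inside a determinant. -/
theorem det_submatrix_inr_eq {R ι κ ν : Type*} [CommRing R] [Fintype ι] [DecidableEq ι]
    [Fintype κ] [DecidableEq κ] [Fintype ν] [DecidableEq ν]
    (A B : Matrix ν ν R) (hAB : A * B = 1) (e e' : ι ⊕ κ ≃ ν) :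
    (A.submatrix (e ∘ Sum.inr) (e' ∘ Sum.inr)).det
      = (A.submatrix e e').det * (B.submatrix (e' ∘ Sum.inl) (e ∘ Sum.inl)).det := by
  set M := A.submatrix e e' with hM
  set N := B.submatrix e' e with hN
  have hMN : M * N = 1 := by
    rw [hM, hN, Matrix.submatrix_mul_equiv, hAB, Matrix.submatrix_one_equiv]
  rw [← Matrix.fromBlocks_toBlocks M, ← Matrix.fromBlocks_toBlocks N,
    Matrix.fromBlocks_multiply, ← Matrix.fromBlocks_one, Matrix.fromBlocks_inj] at hMN
  have key : M * Matrix.fromBlocks N.toBlocks₁₁ 0 N.toBlocks₂₁ 1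
      = Matrix.fromBlocks 1 M.toBlocks₁₂ 0 M.toBlocks₂₂ := by
    conv_lhs => rw [← Matrix.fromBlocks_toBlocks M, Matrix.fromBlocks_multiply]
    rw [hMN.1, hMN.2.2.1]
    simp
  have hdet := congrArg Matrix.det key
  rw [Matrix.det_mul, Matrix.det_fromBlocks_zero₁₂, Matrix.det_fromBlocks_zero₂₁, Matrix.det_one,
    Matrix.det_one, mul_one, one_mul] at hdet
  exact hdet.symm

theorem det_submatrix_finSum {R : Type*} [CommRing R] {d m : ℕ}
    (A : Matrix (Fin (d + m)) (Fin (d + m)) R) (e e' : Fin d ⊕ Fin m ≃ Fin (d + m)) :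
    (A.submatrix e e').det
      = (Equiv.Perm.sign (finSumFinEquiv.symm.trans e) : ℤ)
        * ((Equiv.Perm.sign (finSumFinEquiv.symm.trans e') : ℤ) * A.det) := by
  rw [← Matrix.det_permute', ← Matrix.det_permute, ← Matrix.det_submatrix_equiv_self finSumFinEquiv]
  congr 1
  ext i j
  simp

/-- The enumeration of `Fin (d + m)` listing the shifted parts of a partition first and then the
complementary indices `ρ`. -/
theorem exists_equiv_of_complement (d m : ℕ) (lam : ℕ → ℕ)
    (hlam : ∀ j k : ℕ, 1 ≤ j → j ≤ k → k ≤ d → lam k ≤ lam j)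
    (hm : ∀ j : ℕ, 1 ≤ j → j ≤ d → lam j ≤ m)
    (ρ : ℕ → ℕ) (hρmono : StrictMonoOn ρ (Set.Icc 1 m))
    (hρran : ρ '' Set.Icc 1 m
      = Set.Icc 1 (m + d) \ (fun i => lam (d + 1 - i) + i) '' Set.Icc 1 d) :
    ∃ e : Fin d ⊕ Fin m ≃ Fin (d + m),
      (∀ i, (e (Sum.inl i)).1 = lam (d - i.1) + i.1) ∧
      (∀ j, (e (Sum.inr j)).1 + 1 = ρ (j.1 + 1)) ∧
      Equiv.Perm.sign (finSumFinEquiv.symm.trans e) = (-1) ^ ∑ j ∈ Finset.Icc 1 d, lam j := by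
  have hρmem : ∀ j : Fin m, 1 ≤ ρ (j.1 + 1) ∧ ρ (j.1 + 1) ≤ m + d := by
    intro j
    have hj : ρ (j.1 + 1) ∈ ρ '' Set.Icc 1 m := ⟨j.1 + 1, ⟨by omega, by omega⟩, rfl⟩
    rw [hρran] at hj
    exact hj.1
  have hlt : ∀ i : Fin d, lam (d - i.1) + i.1 < d + m := fun i => by
    have := hm (d - i.1) (by omega) (by omega)
    omega
  let f : Fin d ⊕ Fin m → Fin (d + m) := Sum.elim
    (fun i => ⟨lam (d - i.1) + i.1, hlt i⟩)
    (fun j => ⟨ρ (j.1 + 1) - 1, by have := hρmem j; omega⟩)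
  have hsurj : Function.Surjective f := by
    intro x
    by_cases hx : x.1 + 1 ∈ (fun i => lam (d + 1 - i) + i) '' Set.Icc 1 d
    · obtain ⟨i, ⟨hi1, hid⟩, hi⟩ := hx
      refine ⟨Sum.inl ⟨i - 1, by omega⟩, Fin.ext ?_⟩
      have hsub : d - (i - 1) = d + 1 - i := by omega
      simp only [f, Sum.elim_inl, hsub]
      simp only at hi
      omega
    · have hx' : x.1 + 1 ∈ ρ '' Set.Icc 1 m := by
        rw [hρran]
        exact ⟨⟨by omega, by omega⟩, hx⟩
      obtain ⟨j, ⟨hj1, hjm⟩, hj⟩ := hx'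
      refine ⟨Sum.inr ⟨j - 1, by omega⟩, Fin.ext ?_⟩
      simp only [f, Sum.elim_inr, Nat.sub_add_cancel hj1]
      omega
  have hbij : Function.Bijective f :=
    (Fintype.bijective_iff_surjective_and_card f).2 ⟨hsurj, by simp⟩
  refine ⟨Equiv.ofBijective f hbij, fun i => rfl, fun j => ?_, ?_⟩
  · have := hρmem j
    simp only [Equiv.ofBijective_apply, f, Sum.elim_inr]
    omega
  · rw [sign_of_strictMono_blocks]
    · congr 1
      simp only [Equiv.trans_apply, finSumFinEquiv_symm_apply_castAdd, Equiv.ofBijective_apply, f,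
        Sum.elim_inl, Nat.add_sub_cancel]
      rw [Fin.sum_univ_eq_sum_range (fun i => lam (d - i)) d]
      refine Finset.sum_bij (fun i _ => d - i) ?_ ?_ ?_ (fun _ _ => rfl)
      · intro i hi
        rw [Finset.mem_range] at hi
        rw [Finset.mem_Icc]
        omega
      · intro i hi i' hi' h
        rw [Finset.mem_range] at hi hi'
        omega
      · intro j hj
        rw [Finset.mem_Icc] at hj
        exact ⟨d - j, by rw [Finset.mem_range]; omega, by omega⟩
    · intro i i' hii
      rw [Fin.lt_def] at hii
      have := hlam (d - i'.1) (d - i.1) (by omega) (by omega) (by omega)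
      simp only [Equiv.trans_apply, finSumFinEquiv_symm_apply_castAdd, Equiv.ofBijective_apply, f,
        Sum.elim_inl, Fin.lt_def]
      omega
    · intro j j' hjj
      rw [Fin.lt_def] at hjj
      have := hρmono (a := j.1 + 1) (b := j'.1 + 1) ⟨by omega, by omega⟩ ⟨by omega, by omega⟩
        (by omega)
      have := hρmem j
      simp only [Equiv.trans_apply, finSumFinEquiv_symm_apply_natAdd, Equiv.ofBijective_apply, f,
        Sum.elim_inr, Fin.lt_def]
      omega

theorem aCoeff_eq_upperToeplitz {n : ℕ} (w : ℕ) (z : Fin w → ℂ) (j k : Fin n) :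
    aCoeff w 0 1 z ((j.1 : ℤ) - k.1)
      = upperToeplitz n (PowerSeries.mk fun k : ℕ => (-1 : ℂ) ^ k * eInt w z k) j k := by
  simp only [aCoeff, upperToeplitz, Matrix.of_apply, PowerSeries.coeff_mk, Fin.le_def]
  split_ifs with h
  · have hcast : ((0 : ℕ) : ℤ) - ((j.1 : ℤ) - k.1) = ((k.1 - j.1 : ℕ) : ℤ) := by omega
    rw [hcast, zpow_natCast, mul_one]
  · rw [eInt, if_neg (by omega), mul_zero]

theorem hInt_eq_upperToeplitz {n : ℕ} (w : ℕ) (z : Fin w → ℂ) (j k : Fin n) :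
    hInt w z ((k.1 : ℤ) - j.1)
      = upperToeplitz n (PowerSeries.mk fun k : ℕ => hInt w z k) j k := by
  simp only [upperToeplitz, Matrix.of_apply, PowerSeries.coeff_mk, Fin.le_def]
  split_ifs with h
  · rw [Nat.cast_sub h]
  · rw [hInt, if_neg (by omega)]

/-- Proposition 2: every skew Schur polynomial is a banded Toeplitz minor:
with `n = λ_1 + d`, `ξ = rev(λ) + id_d`, `η = rev(μ) + id_d`, and `ρ, σ` the complements
of `ξ, η` in `{1,…,n}`, one has
`s_{λ/μ}(z_1,…,z_w) = (-1)^{|λ|+|μ|} det(T_n(a)_{ρ,σ})` where `a(t) = t^{-w} ∏ (t - z_j)`. -/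
theorem skewSchur_eq_toeplitz_minor
    (w : ℕ) (hw : 1 ≤ w) (z : Fin w → ℂ)
    (d : ℕ) (lam mu : ℕ → ℕ)
    (hlam : ∀ j k : ℕ, 1 ≤ j → j ≤ k → k ≤ d → lam k ≤ lam j)
    (hmu : ∀ j k : ℕ, 1 ≤ j → j ≤ k → k ≤ d → mu k ≤ mu j)
    (hsub : ∀ j : ℕ, 1 ≤ j → j ≤ d → mu j ≤ lam j)
    (n : ℕ) (hn : n = lam 1 + d)
    (ρ σ : ℕ → ℕ)
    (hρmono : StrictMonoOn ρ (Set.Icc 1 (lam 1)))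
    (hσmono : StrictMonoOn σ (Set.Icc 1 (lam 1)))
    (hρran : ρ '' Set.Icc 1 (lam 1)
      = Set.Icc 1 n \ (fun i => lam (d + 1 - i) + i) '' Set.Icc 1 d)
    (hσran : σ '' Set.Icc 1 (lam 1)
      = Set.Icc 1 n \ (fun i => mu (d + 1 - i) + i) '' Set.Icc 1 d) :
    skewSchur w z d (fun j => (lam j : ℤ)) (fun k => (mu k : ℤ))
      = (-1 : ℂ) ^ ((∑ j ∈ Finset.Icc 1 d, lam j) + ∑ j ∈ Finset.Icc 1 d, mu j)
        * Matrix.det (Matrix.of fun j k : Fin (lam 1) =>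
            aCoeff w 0 1 z ((ρ (j.1 + 1) : ℤ) - (σ (k.1 + 1) : ℤ))) := by
  subst hn
  obtain ⟨e, he₁, he₂, he⟩ := exists_equiv_of_complement d (lam 1) lam hlam
    (fun j h₁ h₂ => hlam 1 j le_rfl h₁ h₂) ρ hρmono hρran
  obtain ⟨e', he'₁, he'₂, he'⟩ := exists_equiv_of_complement d (lam 1) mu hmu
    (fun j h₁ h₂ => (hsub j h₁ h₂).trans (hlam 1 j le_rfl h₁ h₂)) σ hσmono hσran
  set A := upperToeplitz (d + lam 1)
    (PowerSeries.mk fun k : ℕ => (-1 : ℂ) ^ k * eInt w z k) with hA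
  set B := upperToeplitz (d + lam 1) (PowerSeries.mk fun k : ℕ => hInt w z k) with hB
  have hAB : A * B = 1 := by
    rw [hA, hB, upperToeplitz_mul, mk_eInt_mul_mk_hInt, upperToeplitz_one]
  have hdetA : A.det = 1 := by
    rw [hA, det_upperToeplitz]
    simp [eInt]
  have hminor : (Matrix.of fun j k : Fin (lam 1) =>
      aCoeff w 0 1 z ((ρ (j.1 + 1) : ℤ) - (σ (k.1 + 1) : ℤ)))
      = A.submatrix (e ∘ Sum.inr) (e' ∘ Sum.inr) := by
    ext j k
    rw [Matrix.submatrix_apply, hA, ← aCoeff_eq_upperToeplitz, Matrix.of_apply, ← he₂, ← he'₂]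
    simp
  have hschur : skewSchur w z d (fun j => (lam j : ℤ)) (fun k => (mu k : ℤ))
      = (B.submatrix (e' ∘ Sum.inl) (e ∘ Sum.inl)).det := by
    rw [skewSchur, ← Matrix.det_transpose, ← Matrix.det_submatrix_equiv_self Fin.revPerm]
    congr 1
    ext j k
    rw [Matrix.submatrix_apply, Matrix.submatrix_apply, hB, ← hInt_eq_upperToeplitz,
      Matrix.transpose_apply, Matrix.of_apply]
    simp only [Function.comp_apply, he₁, he'₁, Fin.revPerm_apply, Fin.val_rev]
    have hj : d - (j.1 + 1) + 1 = d - j.1 := by omega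
    have hk : d - (k.1 + 1) + 1 = d - k.1 := by omega
    rw [hj, hk]
    congr 1
    omega
  rw [hminor, det_submatrix_inr_eq A B hAB e e', det_submatrix_finSum, hdetA, he, he', hschur]
  push_cast
  rw [mul_one, ← pow_add, ← mul_assoc, ← mul_pow]
  simp
end

section
/- Let w ≥ 1 and z_1,…,z_w be complex numbers, let n ≥ 1, 0 ≤ m ≤ n, d = n − m, let ρ, σ be strictly increasing m-tuples with entries in {1,…,n}, and let ξ, η be the complements of ρ and σ in {1,…,n}. Let b(t) = Σ_{k=0}^w e_k t^{−k}, so (T_n(b))_{j,k} = e_{k−j}. Then det(T_n(b)_{ρ,σ}) = s_{(m^d + id_d − η)/(m^d + id_d − ξ)}(z_1,…,z_w), i.e. the skew Schur polynomial with outer partition (m+1−η_1, m+2−η_2, …, m+d−η_d) and inner partition (m+1−ξ_1, …, m+d−ξ_d). -/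
open scoped BigOperators

theorem PowerSeries.mk_eInt (w : ℕ) (z : Fin w → ℂ) :
    PowerSeries.mk (fun r => eInt w z r) = ∏ i, (1 + PowerSeries.C (z i) * PowerSeries.X) := by
  ext r
  rw [Finset.prod_one_add, PowerSeries.coeff_mk, map_sum, eInt, if_pos (Int.natCast_nonneg r),
    Int.toNat_natCast, Finset.powersetCard_eq_filter, Finset.sum_filter]
  refine Finset.sum_congr rfl fun s _ => ?_
  rw [Finset.prod_mul_distrib, Finset.prod_const, ← map_prod, PowerSeries.coeff_C_mul_X_pow]
  simp only [eq_comm]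

theorem PowerSeries.mk_hInt (w : ℕ) (z : Fin w → ℂ) :
    PowerSeries.mk (fun r => hInt w z r) = ∏ i, PowerSeries.mk (fun r => z i ^ r) := by
  ext r
  rw [PowerSeries.coeff_prod, PowerSeries.coeff_mk, hInt, if_pos (Int.natCast_nonneg r),
    Int.toNat_natCast]
  simp only [PowerSeries.coeff_mk]
  refine Finset.sum_bij (fun s _ => Multiset.toFinsupp s.1) ?_ ?_ ?_ ?_
  · intro s _
    rw [Finset.mem_finsuppAntidiag]
    refine ⟨?_, Finset.subset_univ _⟩
    exact (Multiset.sum_count_eq_card fun i _ => Finset.mem_univ i).trans s.2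
  · intro s _ t _ h
    exact Subtype.ext (Multiset.toFinsupp.injective h)
  · intro l hl
    rw [Finset.mem_finsuppAntidiag] at hl
    refine ⟨⟨Finsupp.toMultiset l, ?_⟩, Finset.mem_univ _, by simp⟩
    rw [Finsupp.card_toMultiset, Finsupp.sum_fintype _ _ (by simp)]
    exact hl.1
  · intro s _
    rw [Finset.prod_multiset_map_count]
    refine Finset.prod_subset (Finset.subset_univ _) fun i _ hi => ?_
    rw [Multiset.count_eq_zero_of_notMem (by simpa using hi), pow_zero]

theorem PowerSeries.mk_eInt_mul_mk_hInt_neg (w : ℕ) (z : Fin w → ℂ) :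
    PowerSeries.mk (fun r => eInt w z r) * PowerSeries.mk (fun r => hInt w (-z) r) = 1 := by
  rw [PowerSeries.mk_eInt, PowerSeries.mk_hInt, ← Finset.prod_mul_distrib]
  refine Finset.prod_eq_one fun i _ => ?_
  ext r
  rw [add_mul, one_mul, mul_assoc, map_add, PowerSeries.coeff_C_mul]
  cases r with
  | zero => simp
  | succ r =>
    rw [PowerSeries.coeff_succ_X_mul]
    simp only [PowerSeries.coeff_mk, PowerSeries.coeff_one, Pi.neg_apply, pow_succ,
      Nat.succ_ne_zero, if_false]
    ring

theorem eInt_of_neg (w : ℕ) (z : Fin w → ℂ) {r : ℤ} (hr : r < 0) : eInt w z r = 0 :=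
  if_neg (not_le.mpr hr)

theorem hInt_of_neg (w : ℕ) (z : Fin w → ℂ) {r : ℤ} (hr : r < 0) : hInt w z r = 0 :=
  if_neg (not_le.mpr hr)

theorem eInt_zero (w : ℕ) (z : Fin w → ℂ) : eInt w z 0 = 1 := by
  simp [eInt]

theorem hInt_neg_sub (w : ℕ) (z : Fin w → ℂ) (a b : ℕ) :
    hInt w (-z) ((a : ℤ) - b) = (-1) ^ b * ((-1) ^ a * hInt w z ((a : ℤ) - b)) := by
  rcases lt_or_ge a b with h | h
  · rw [hInt_of_neg _ _ (by omega), hInt_of_neg _ _ (by omega), mul_zero, mul_zero]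
  · obtain ⟨c, rfl⟩ := Nat.exists_eq_add_of_le h
    have hsign : ((-1 : ℂ) ^ b * (-1) ^ (b + c)) = (-1) ^ c := by
      rw [pow_add, ← mul_assoc, ← mul_pow]; simp
    rw [← mul_assoc, hsign, Nat.cast_add, add_sub_cancel_left, hInt, hInt,
      if_pos (Int.natCast_nonneg c), if_pos (Int.natCast_nonneg c), Finset.mul_sum]
    refine Finset.sum_congr rfl fun s _ => ?_
    have hs : Multiset.card s.1 = c := s.2
    rw [show (-z : Fin w → ℂ) = fun i => -1 * z i by ext; simp, Multiset.prod_map_mul,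
      Multiset.map_const', Multiset.prod_replicate, hs]

theorem toeplitz_eInt_mul_toeplitz_hInt_neg (w : ℕ) (z : Fin w → ℂ) (n : ℕ) :
    toeplitz n (fun r => eInt w z (-r)) * toeplitz n (fun r => hInt w (-z) (-r)) = 1 := by
  ext j k
  simp only [Matrix.mul_apply, toeplitz, Matrix.of_apply, neg_sub]
  rw [Fin.sum_univ_eq_sum_range
    (fun i => eInt w z ((i : ℤ) - (j : ℕ)) * hInt w (-z) (((k : ℕ) : ℤ) - i))]
  have hsub : Finset.Ico (j : ℕ) (k + 1) ⊆ Finset.range n := by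
    intro i hi
    rw [Finset.mem_Ico] at hi
    rw [Finset.mem_range]
    omega
  rw [← Finset.sum_subset hsub]
  · rw [Finset.sum_Ico_eq_sum_range]
    rcases lt_or_ge (k : ℕ) j with h | h
    · rw [show (k : ℕ) + 1 - j = 0 by omega, Finset.sum_range_zero,
        Matrix.one_apply_ne (by rintro rfl; exact lt_irrefl _ h)]
    · obtain ⟨c, hc⟩ := Nat.exists_eq_add_of_le h
      have key := congrArg (PowerSeries.coeff c) (PowerSeries.mk_eInt_mul_mk_hInt_neg w z)
      rw [PowerSeries.coeff_mul, Finset.Nat.sum_antidiagonal_eq_sum_range_succ_mk,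
        PowerSeries.coeff_one] at key
      have hjk : (1 : Matrix (Fin n) (Fin n) ℂ) j k = if c = 0 then 1 else 0 := by
        rw [Matrix.one_apply]
        exact if_congr (by rw [Fin.ext_iff]; omega) rfl rfl
      rw [hjk, ← key, show (k : ℕ) + 1 - j = c.succ by omega]
      refine Finset.sum_congr rfl fun t ht => ?_
      rw [Finset.mem_range] at ht
      rw [PowerSeries.coeff_mk, PowerSeries.coeff_mk]
      congr 2 <;> omega
  · intro i _ hi
    rw [Finset.mem_Ico] at hi
    by_cases h : i < j
    · rw [eInt_of_neg _ _ (by omega), zero_mul]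
    · rw [hInt_of_neg _ _ (by omega), mul_zero]

theorem det_toeplitz_eInt (w : ℕ) (z : Fin w → ℂ) (n : ℕ) :
    (toeplitz n (fun r => eInt w z (-r))).det = 1 := by
  rw [Matrix.det_of_isUpperTriangular]
  · simp [toeplitz, eInt_zero]
  · intro j k hjk
    simp only [id] at hjk
    simp only [toeplitz, Matrix.of_apply]
    exact eInt_of_neg _ _ (by rw [Fin.lt_def] at hjk; omega)

/-- Jacobi's complementary minor identity for block matrices. -/
theorem Matrix.det_toBlocks₁₁_of_mul_eq_one {m d R : Type*} [Fintype m] [DecidableEq m]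
    [Fintype d] [DecidableEq d] [CommRing R] {P Q : Matrix (m ⊕ d) (m ⊕ d) R} (h : P * Q = 1) :
    P.toBlocks₁₁.det = P.det * Q.toBlocks₂₂.det := by
  rw [← Matrix.fromBlocks_toBlocks P, ← Matrix.fromBlocks_toBlocks Q, Matrix.fromBlocks_multiply,
    ← Matrix.fromBlocks_one, Matrix.fromBlocks_inj] at h
  obtain ⟨-, h12, -, h22⟩ := h
  have hmul : P * Matrix.fromBlocks 1 Q.toBlocks₁₂ 0 Q.toBlocks₂₂
      = Matrix.fromBlocks P.toBlocks₁₁ 0 P.toBlocks₂₁ 1 := by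
    conv_lhs => rw [← Matrix.fromBlocks_toBlocks P]
    rw [Matrix.fromBlocks_multiply, h12, h22]
    simp
  have hdet := congrArg Matrix.det hmul
  rw [Matrix.det_mul, Matrix.det_fromBlocks_zero₂₁, Matrix.det_fromBlocks_zero₁₂,
    Matrix.det_one, Matrix.det_one, one_mul, mul_one] at hdet
  exact hdet.symm

/-- The parity of the number of elements of the first block exceeding an element of the second. -/
theorem prod_shuffle_ite {m d : ℕ} (p : Fin m ⊕ Fin d ≃ Fin (m + d))
    (hr : StrictMono (fun k => p (Sum.inr k))) (k : Fin d) :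
    (∏ i : Fin m, if p (Sum.inl i) < p (Sum.inr k) then (1 : ℤˣ) else -1)
      = (-1) ^ m * (-1) ^ (p (Sum.inr k) : ℕ) * (-1) ^ (k : ℕ) := by
  have count : ∀ {N : ℕ} (a : Fin N),
      (∏ x : Fin N, if x < a then (-1 : ℤˣ) else 1) = (-1) ^ (a : ℕ) := by
    intro N a
    rw [← Finset.prod_filter, Finset.prod_const, Finset.filter_gt_eq_Iio, Fin.card_Iio]
  have h := count (p (Sum.inr k))
  rw [← p.prod_comp, Fintype.prod_sum_type] at h
  simp only [hr.lt_iff_lt] at h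
  rw [count k] at h
  have h' : (∏ i : Fin m, if p (Sum.inl i) < p (Sum.inr k) then (1 : ℤˣ) else -1)
      = (-1) ^ m * ∏ i : Fin m, if p (Sum.inl i) < p (Sum.inr k) then (-1 : ℤˣ) else 1 := by
    have : ((-1 : ℤˣ)) ^ m = ∏ _i : Fin m, (-1 : ℤˣ) := by simp
    rw [this, ← Finset.prod_mul_distrib]
    refine Finset.prod_congr rfl fun i _ => ?_
    split_ifs <;> simp
  rw [h', mul_assoc, ← h, mul_assoc, ← mul_pow]
  simp

theorem sign_shuffle {m d : ℕ} (p : Fin m ⊕ Fin d ≃ Fin (m + d))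
    (hl : StrictMono (fun k => p (Sum.inl k))) (hr : StrictMono (fun k => p (Sum.inr k))) :
    Equiv.Perm.sign (finSumFinEquiv.symm.trans p)
      = ∏ k : Fin d, ((-1) ^ m * (-1) ^ (p (Sum.inr k) : ℕ) * (-1) ^ (k : ℕ)) := by
  rw [Equiv.Perm.sign_eq_prod_prod_Iio]
  have hfull : ∀ j : Fin (m + d), ∀ f : Fin (m + d) → ℤˣ,
      ∏ i ∈ Finset.Iio j, f i = ∏ i, if i < j then f i else 1 := by
    intro j f
    rw [← Finset.filter_gt_eq_Iio, Finset.prod_filter]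
  simp only [hfull, Fin.prod_univ_add, Equiv.trans_apply, finSumFinEquiv_symm_apply_castAdd,
    finSumFinEquiv_symm_apply_natAdd]
  rw [Finset.prod_eq_one, one_mul]
  · refine Finset.prod_congr rfl fun k _ => ?_
    rw [← prod_shuffle_ite p hr k]
    have h1 : ∀ i : Fin m, Fin.castAdd d i < Fin.natAdd m k := fun i => by
      rw [Fin.lt_def, Fin.val_castAdd, Fin.val_natAdd]; omega
    simp only [h1, if_true]
    rw [mul_eq_left]
    refine Finset.prod_eq_one fun i _ => ?_
    by_cases hik : i < k
    · rw [if_pos (hr hik)]; simp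
    · rw [if_neg (by simpa using hik)]
  · intro j _
    rw [Finset.prod_eq_one, one_mul]
    · refine Finset.prod_eq_one fun i _ => if_neg ?_
      rw [Fin.lt_def, Fin.val_castAdd, Fin.val_natAdd]; omega
    · intro i _
      by_cases hij : i < j
      · rw [if_pos (hl hij)]; simp
      · rw [if_neg (show ¬ Fin.castAdd d i < Fin.castAdd d j from hij)]

theorem det_submatrix_shuffle {m d : ℕ} {R : Type*} [CommRing R]
    (M : Matrix (Fin (m + d)) (Fin (m + d)) R) {p q : Fin m ⊕ Fin d ≃ Fin (m + d)}
    (hpl : StrictMono (fun k => p (Sum.inl k))) (hpr : StrictMono (fun k => p (Sum.inr k)))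
    (hql : StrictMono (fun k => q (Sum.inl k))) (hqr : StrictMono (fun k => q (Sum.inr k))) :
    (M.submatrix p q).det
      = (∏ k : Fin d, (-1) ^ (p (Sum.inr k) : ℕ)) * (∏ k : Fin d, (-1) ^ (q (Sum.inr k) : ℕ))
        * M.det := by
  have hM : M.submatrix p q = ((M.submatrix (finSumFinEquiv.symm.trans p) id).submatrix id
      (finSumFinEquiv.symm.trans q)).submatrix finSumFinEquiv finSumFinEquiv := by
    ext i j; simp
  have hsign : Equiv.Perm.sign (finSumFinEquiv.symm.trans p)
      * Equiv.Perm.sign (finSumFinEquiv.symm.trans q)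
      = (∏ k : Fin d, (-1) ^ (p (Sum.inr k) : ℕ)) * ∏ k : Fin d, (-1) ^ (q (Sum.inr k) : ℕ) := by
    rw [sign_shuffle p hpl hpr, sign_shuffle q hql hqr, ← Finset.prod_mul_distrib,
      ← Finset.prod_mul_distrib]
    refine Finset.prod_congr rfl fun k _ => ?_
    rw [mul_mul_mul_comm, mul_mul_mul_comm ((-1 : ℤˣ) ^ m), ← mul_pow, ← mul_pow (-1) (-1) (k : ℕ)]
    simp
  rw [hM, Matrix.det_submatrix_equiv_self, Matrix.det_permute', Matrix.det_permute, ← mul_assoc,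
    mul_comm (((Equiv.Perm.sign _ : ℤˣ) : ℤ) : R), ← Int.cast_mul, ← Units.val_mul, hsign]
  simp

theorem det_eInt_shuffle_eq_det_hInt (w : ℕ) (z : Fin w → ℂ) {m d : ℕ}
    {p q : Fin m ⊕ Fin d ≃ Fin (m + d)}
    (hpl : StrictMono (fun k => p (Sum.inl k))) (hpr : StrictMono (fun k => p (Sum.inr k)))
    (hql : StrictMono (fun k => q (Sum.inl k))) (hqr : StrictMono (fun k => q (Sum.inr k))) :
    (Matrix.of fun j k : Fin m =>
        eInt w z (((q (Sum.inl k) : ℕ) : ℤ) - (p (Sum.inl j) : ℕ))).det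
      = (Matrix.of fun j k : Fin d =>
        hInt w z (((p (Sum.inr k) : ℕ) : ℤ) - (q (Sum.inr j) : ℕ))).det := by
  have hmul : (toeplitz (m + d) (fun r => eInt w z (-r))).submatrix p q
      * (toeplitz (m + d) (fun r => hInt w (-z) (-r))).submatrix q p = 1 := by
    rw [Matrix.submatrix_mul_equiv, toeplitz_eInt_mul_toeplitz_hInt_neg, Matrix.submatrix_one_equiv]
  have hJ := Matrix.det_toBlocks₁₁_of_mul_eq_one hmul
  rw [det_submatrix_shuffle _ hpl hpr hql hqr, det_toeplitz_eInt, mul_one] at hJ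
  have hE : ((toeplitz (m + d) (fun r => eInt w z (-r))).submatrix p q).toBlocks₁₁
      = Matrix.of fun j k : Fin m =>
        eInt w z (((q (Sum.inl k) : ℕ) : ℤ) - (p (Sum.inl j) : ℕ)) := by
    ext j k; simp [toeplitz, Matrix.toBlocks₁₁]
  have hH : ((toeplitz (m + d) (fun r => hInt w (-z) (-r))).submatrix q p).toBlocks₂₂
      = Matrix.of fun j k : Fin d => (-1) ^ (q (Sum.inr j) : ℕ) *
        Matrix.of (fun j k : Fin d => (-1) ^ (p (Sum.inr k) : ℕ) *
          Matrix.of (fun j k : Fin d =>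
            hInt w z (((p (Sum.inr k) : ℕ) : ℤ) - (q (Sum.inr j) : ℕ))) j k) j k := by
    ext j k; simp [toeplitz, Matrix.toBlocks₂₂, hInt_neg_sub]
  rw [hE, hH, Matrix.det_mul_column, Matrix.det_mul_row] at hJ
  have hsq : ∀ f : Fin d → ℕ, (∏ k, (-1 : ℂ) ^ f k) * ∏ k, (-1 : ℂ) ^ f k = 1 := by
    intro f
    rw [← Finset.prod_mul_distrib]
    exact Finset.prod_eq_one fun k _ => by rw [← mul_pow]; simp
  rw [hJ]
  linear_combination (Matrix.of fun j k : Fin d =>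
    hInt w z (((p (Sum.inr k) : ℕ) : ℤ) - (q (Sum.inr j) : ℕ))).det *
    ((∏ k, (-1 : ℂ) ^ (q (Sum.inr k) : ℕ)) * (∏ k, (-1 : ℂ) ^ (q (Sum.inr k) : ℕ))
      * hsq (fun k => p (Sum.inr k)) + hsq (fun k => q (Sum.inr k)))

theorem exists_shuffle {m d : ℕ} {ρ ξ : ℕ → ℕ}
    (hρ : StrictMonoOn ρ (Set.Icc 1 m)) (hξ : StrictMonoOn ξ (Set.Icc 1 d))
    (hρran : ρ '' Set.Icc 1 m ⊆ Set.Icc 1 (m + d))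
    (hξran : ξ '' Set.Icc 1 d = Set.Icc 1 (m + d) \ ρ '' Set.Icc 1 m) :
    ∃ p : Fin m ⊕ Fin d ≃ Fin (m + d),
      StrictMono (fun k => p (Sum.inl k)) ∧ StrictMono (fun k => p (Sum.inr k)) ∧
      (∀ k : Fin m, ρ (k + 1) = p (Sum.inl k) + 1) ∧
      ∀ k : Fin d, ξ (k + 1) = p (Sum.inr k) + 1 := by
  have mem : ∀ {N : ℕ} (k : Fin N), (k : ℕ) + 1 ∈ Set.Icc 1 N := fun k =>
    Set.mem_Icc.mpr ⟨by omega, k.2⟩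
  have hρk : ∀ k : Fin m, 1 ≤ ρ (k + 1) ∧ ρ (k + 1) ≤ m + d := fun k =>
    hρran ⟨_, mem k, rfl⟩
  have hξk' : ∀ k : Fin d, ξ (k + 1) ∈ Set.Icc 1 (m + d) \ ρ '' Set.Icc 1 m := fun k =>
    hξran ▸ ⟨_, mem k, rfl⟩
  have hξk : ∀ k : Fin d, 1 ≤ ξ (k + 1) ∧ ξ (k + 1) ≤ m + d := fun k => (hξk' k).1
  have hne : ∀ (i : Fin m) (k : Fin d), ρ (i + 1) ≠ ξ (k + 1) := fun i k h =>
    (hξk' k).2 ⟨_, mem i, h⟩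
  have hρlt : ∀ i j : Fin m, i < j → ρ (i + 1) < ρ (j + 1) := fun i j h =>
    hρ (mem i) (mem j) (by rw [Fin.lt_def] at h; omega)
  have hξlt : ∀ i j : Fin d, i < j → ξ (i + 1) < ξ (j + 1) := fun i j h =>
    hξ (mem i) (mem j) (by rw [Fin.lt_def] at h; omega)
  let f : Fin m ⊕ Fin d → Fin (m + d) := Sum.elim
    (fun k => ⟨ρ (k + 1) - 1, by have := hρk k; omega⟩)
    (fun k => ⟨ξ (k + 1) - 1, by have := hξk k; omega⟩)
  have hl : StrictMono (fun k => f (Sum.inl k)) := fun i j h => by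
    have := hρlt i j h
    have := hρk i
    simp only [f, Sum.elim_inl, Fin.lt_def]
    omega
  have hr : StrictMono (fun k => f (Sum.inr k)) := fun i j h => by
    have := hξlt i j h
    have := hξk i
    simp only [f, Sum.elim_inr, Fin.lt_def]
    omega
  have hdisj : ∀ i k, f (Sum.inl i) ≠ f (Sum.inr k) := fun i k h => by
    have h1 := hne i k
    have h2 := hρk i
    have h3 := hξk k
    simp only [f, Sum.elim_inl, Sum.elim_inr, Fin.mk.injEq] at h
    omega
  have hinj : Function.Injective f := by
    rintro (i | i) (j | j) h
    · exact congrArg _ (hl.injective h)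
    · exact absurd h (hdisj i j)
    · exact absurd h.symm (hdisj j i)
    · exact congrArg _ (hr.injective h)
  have hbij : Function.Bijective f := by
    rw [Fintype.bijective_iff_injective_and_card]
    exact ⟨hinj, by simp⟩
  refine ⟨Equiv.ofBijective f hbij, hl, hr, fun k => ?_, fun k => ?_⟩
  · have := hρk k
    simp only [Equiv.ofBijective_apply, f, Sum.elim_inl]
    omega
  · have := hξk k
    simp only [Equiv.ofBijective_apply, f, Sum.elim_inr]
    omega

/-- Lemma 3, formula (eq:Alexandersson_triangular_xieta): for the upper triangular Toeplitz
matrix `(T_n(b))_{j,k} = e_{k-j}`,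
`det(T_n(b)_{ρ,σ}) = s_{(m^d + id_d - η)/(m^d + id_d - ξ)}(z_1,…,z_w)`,
with outer partition `(m+1-η_1, …, m+d-η_d)` and inner partition `(m+1-ξ_1, …, m+d-ξ_d)`. -/
theorem triangular_toeplitz_minor_eq_skewSchur_alexandersson
    (w : ℕ) (hw : 1 ≤ w) (z : Fin w → ℂ)
    (n m d : ℕ) (hn : 1 ≤ n) (hmn : m ≤ n) (hd : d = n - m)
    (ρ σ ξ η : ℕ → ℕ)
    (hρmono : StrictMonoOn ρ (Set.Icc 1 m)) (hσmono : StrictMonoOn σ (Set.Icc 1 m))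
    (hξmono : StrictMonoOn ξ (Set.Icc 1 d)) (hηmono : StrictMonoOn η (Set.Icc 1 d))
    (hρran : ρ '' Set.Icc 1 m ⊆ Set.Icc 1 n)
    (hσran : σ '' Set.Icc 1 m ⊆ Set.Icc 1 n)
    (hξran : ξ '' Set.Icc 1 d = Set.Icc 1 n \ ρ '' Set.Icc 1 m)
    (hηran : η '' Set.Icc 1 d = Set.Icc 1 n \ σ '' Set.Icc 1 m) :
    Matrix.det (Matrix.of fun j k : Fin m =>
        eInt w z ((σ (k.1 + 1) : ℤ) - (ρ (j.1 + 1) : ℤ)))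
      = skewSchur w z d
          (fun j => (m : ℤ) + (j : ℤ) - (η j : ℤ))
          (fun k => (m : ℤ) + (k : ℤ) - (ξ k : ℤ)) := by
  obtain rfl : n = m + d := by omega
  obtain ⟨p, hpl, hpr, hpρ, hpξ⟩ := exists_shuffle hρmono hξmono hρran hξran
  obtain ⟨q, hql, hqr, hqσ, hqη⟩ := exists_shuffle hσmono hηmono hσran hηran
  rw [skewSchur]
  convert det_eInt_shuffle_eq_det_hInt w z hpl hpr hql hqr using 5 with j k j k
  · rw [hqσ, hpρ]; push_cast; ring_nf
  · rw [hpξ, hqη]; push_cast; ring_nf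
end

section
/- Let w ≥ 1, let z_1,…,z_w be complex numbers, let p ∈ ℕ, a_p ∈ ℂ with a_p ≠ 0, let 1 ≤ m ≤ n, and let ρ = (ρ_1 < … < ρ_m), σ = (σ_1 < … < σ_m) be strictly increasing tuples with entries in {1,…,n}. Then det(T_n(a)_{ρ,σ}) = (−1)^{|ρ| + |σ| + mp} · a_p^m · det[e_{p + σ_k − ρ_j}]_{j,k=1}^m, where |ρ| = ρ_1 + ⋯ + ρ_m and |σ| = σ_1 + ⋯ + σ_m. Equivalently, the minor of T_n(a) on rows ρ and columns σ equals (−1)^{|ρ|+|σ|+mp} a_p^m times the minor of the upper triangular Toeplitz matrix T_{n+p}(b), b(t) = Σ_{k=0}^w e_k t^{−k}, on rows ρ and columns σ + (p,…,p). -/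
open scoped BigOperators

theorem prod_fin_neg_one_pow_eq (m : ℕ) (f : ℕ → ℕ) :
    ∏ j : Fin m, (-1 : ℂ) ^ f (j.1 + 1) = (-1 : ℂ) ^ ∑ j ∈ Finset.Icc 1 m, f j := by
  rw [Fin.prod_univ_eq_prod_range (fun j => (-1 : ℂ) ^ f (j + 1)), Finset.prod_pow_eq_pow_sum,
    Finset.range_eq_Ico, Finset.sum_Ico_add' f 0 m 1, zero_add, Finset.Ico_add_one_right_eq_Icc]

theorem aCoeff_natCast_sub (w p : ℕ) (ap : ℂ) (z : Fin w → ℂ) (r s : ℕ) :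
    aCoeff w p ap z ((r : ℤ) - s)
      = (-1 : ℂ) ^ r * ((-1 : ℂ) ^ s * ((-1 : ℂ) ^ p * ap) * eInt w z ((p : ℤ) + s - r)) := by
  have h : (p : ℤ) - (r - s) = (p : ℤ) + s - r := by ring
  have hr : ((-1 : ℂ) ^ r)⁻¹ = (-1 : ℂ) ^ r := by rw [← inv_pow, inv_neg_one]
  have h0 : (-1 : ℂ) ≠ 0 := by simp
  rw [aCoeff, h, zpow_sub₀ h0, zpow_add₀ h0, zpow_natCast, zpow_natCast, zpow_natCast,
    div_eq_mul_inv, hr]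
  ring

/-- Lemma 4, formula (eq:Tminor_through_dete): reduction of a general banded Toeplitz minor
to a minor of the triangular Toeplitz matrix of elementary symmetric polynomials:
`det(T_n(a)_{ρ,σ}) = (-1)^{|ρ|+|σ|+mp} a_p^m det[e_{p + σ_k - ρ_j}]_{j,k=1}^m`. -/
theorem toeplitz_minor_reduction_to_triangular
    (w : ℕ) (hw : 1 ≤ w) (z : Fin w → ℂ) (p : ℕ) (ap : ℂ) (hap : ap ≠ 0)
    (n m : ℕ) (hm : 1 ≤ m) (hmn : m ≤ n)
    (ρ σ : ℕ → ℕ)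
    (hρmono : StrictMonoOn ρ (Set.Icc 1 m)) (hσmono : StrictMonoOn σ (Set.Icc 1 m))
    (hρran : ρ '' Set.Icc 1 m ⊆ Set.Icc 1 n)
    (hσran : σ '' Set.Icc 1 m ⊆ Set.Icc 1 n) :
    Matrix.det (Matrix.of fun j k : Fin m =>
        aCoeff w p ap z ((ρ (j.1 + 1) : ℤ) - (σ (k.1 + 1) : ℤ)))
      = (-1 : ℂ) ^ ((∑ j ∈ Finset.Icc 1 m, ρ j) + (∑ j ∈ Finset.Icc 1 m, σ j) + m * p)
        * ap ^ m
        * Matrix.det (Matrix.of fun j k : Fin m =>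
            eInt w z ((p : ℤ) + (σ (k.1 + 1) : ℤ) - (ρ (j.1 + 1) : ℤ))) := by
  simp_rw [aCoeff_natCast_sub]
  have hrow := Matrix.det_mul_column (fun j : Fin m => (-1 : ℂ) ^ ρ (j.1 + 1))
    (Matrix.of fun j k : Fin m => (-1 : ℂ) ^ σ (k.1 + 1) * ((-1 : ℂ) ^ p * ap)
      * eInt w z ((p : ℤ) + (σ (k.1 + 1) : ℤ) - (ρ (j.1 + 1) : ℤ)))
  have hcol := Matrix.det_mul_row (fun k : Fin m => (-1 : ℂ) ^ σ (k.1 + 1) * ((-1 : ℂ) ^ p * ap))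
    (Matrix.of fun j k : Fin m =>
      eInt w z ((p : ℤ) + (σ (k.1 + 1) : ℤ) - (ρ (j.1 + 1) : ℤ)))
  simp only [Matrix.of_apply] at hrow hcol
  rw [hrow, hcol, Finset.prod_mul_distrib, prod_fin_neg_one_pow_eq, prod_fin_neg_one_pow_eq,
    Finset.prod_const, Finset.card_univ, Fintype.card_fin, mul_pow]
  ring
end

section
/- Let w ≥ 1, let z_1,…,z_w be complex numbers, let p ≥ 1, a_p ∈ ℂ with a_p ≠ 0, and let n ≥ 1. Then for every r ∈ {1,…,n}, the (r,1) entry of the adjugate matrix satisfies adj(T_n(a))_{r,1} = (−1)^{p(n−1)} · a_p^{n−1} · s_{((n−1)^{p−1}, n−r)}(z_1,…,z_w), where ((n−1)^{p−1}, n−r) is the partition with n−1 repeated p−1 times followed by the part n−r. -/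
open scoped BigOperators

/-- The coefficients of a power series, extended by `0` to negative integer indices. -/
noncomputable def coeffInt {R : Type*} [CommRing R] (f : PowerSeries R) (d : ℤ) : R :=
  if 0 ≤ d then PowerSeries.coeff d.toNat f else 0

theorem coeffInt_of_neg {R : Type*} [CommRing R] (f : PowerSeries R) {d : ℤ} (hd : d < 0) :
    coeffInt f d = 0 := if_neg (by omega)

theorem coeffInt_natCast {R : Type*} [CommRing R] (f : PowerSeries R) (d : ℕ) :
    coeffInt f d = PowerSeries.coeff d f := by simp [coeffInt]

/-- Row `i` of the upper triangular Toeplitz matrix of `f` times column `j` of that of `g` is the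
coefficient of index `j - i` in `f * g`. -/
theorem sum_coeffInt_mul_coeffInt {R : Type*} [CommRing R] (f g : PowerSeries R)
    {N i j : ℕ} (hj : j < N) :
    ∑ k : Fin N, coeffInt f ((k : ℤ) - i) * coeffInt g ((j : ℤ) - k) =
      coeffInt (f * g) ((j : ℤ) - i) := by
  rw [Fin.sum_univ_eq_sum_range (fun k : ℕ => coeffInt f ((k : ℤ) - i) * coeffInt g ((j : ℤ) - k))]
  rcases lt_or_ge j i with h | h
  · rw [coeffInt_of_neg _ (by omega)]
    refine Finset.sum_eq_zero fun k _ => ?_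
    rcases lt_or_ge k i with h' | h'
    · rw [coeffInt_of_neg f (by omega), zero_mul]
    · rw [coeffInt_of_neg g (by omega), mul_zero]
  · obtain ⟨d, rfl⟩ := Nat.exists_eq_add_of_le h
    rw [show ((i + d : ℕ) : ℤ) - i = (d : ℕ) by push_cast; ring, coeffInt_natCast,
      PowerSeries.coeff_mul, Finset.Nat.sum_antidiagonal_eq_sum_range_succ_mk]
    have hsub : Finset.Ico i (i + d + 1) ⊆ Finset.range N := by
      intro k hk
      simp only [Finset.mem_Ico, Finset.mem_range] at *
      omega
    rw [← Finset.sum_subset hsub, Finset.sum_Ico_eq_sum_range,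
      show i + d + 1 - i = d.succ by omega]
    · refine Finset.sum_congr rfl fun k hk => ?_
      have hk' : k ≤ d := by simpa [Nat.lt_succ_iff] using hk
      rw [show ((i + k : ℕ) : ℤ) - i = (k : ℕ) by push_cast; ring,
        show ((i + d : ℕ) : ℤ) - (i + k : ℕ) = (d - k : ℕ) by omega,
        coeffInt_natCast, coeffInt_natCast]
    · intro k _ hk
      simp only [Finset.mem_Ico, not_and_or, not_le, not_lt] at hk
      rcases hk with hk | hk
      · rw [coeffInt_of_neg f (by omega), zero_mul]
      · rw [coeffInt_of_neg g (by omega), mul_zero]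

theorem coeffInt_one {R : Type*} [CommRing R] (i j : ℕ) :
    coeffInt (1 : PowerSeries R) ((j : ℤ) - i) = if i = j then 1 else 0 := by
  unfold coeffInt
  rw [PowerSeries.coeff_one]
  split_ifs <;> first | rfl | omega

theorem finRotate_pow_val (n m : ℕ) (i : Fin (n + 1)) :
    (((finRotate (n + 1)) ^ m) i : ℕ) = (i + m) % (n + 1) := by
  induction m with
  | zero => simp [Nat.mod_eq_of_lt i.2]
  | succ m ih =>
    rw [pow_succ', Equiv.Perm.mul_apply, finRotate_apply, Fin.val_add, ih, Fin.val_one',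
      ← Nat.add_mod, add_assoc]

/-- The matrix whose first `m` rows are those of the upper triangular Toeplitz matrix of `f`,
followed by the unit rows with indices `0, …, q - 1` and `q + r`. -/
noncomputable def toeplitzUnitRows {R : Type*} [CommRing R] (f : PowerSeries R) (m q r : ℕ) :
    Matrix (Fin (m + q + 1)) (Fin (m + q + 1)) R :=
  Matrix.of fun i k =>
    if (i : ℕ) < m then coeffInt f ((k : ℤ) - (i : ℕ))
    else if (k : ℕ) = (if (i : ℕ) < m + q then (i : ℕ) - m else q + r) then 1 else 0

theorem det_toeplitzUnitRows {R : Type*} [CommRing R] {f g : PowerSeries R} (hfg : f * g = 1)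
    (hg : PowerSeries.coeff 0 g = 1) {m q r : ℕ} (hr : r ≤ m) :
    (toeplitzUnitRows f m q r).det =
      Matrix.det (Matrix.of fun i k : Fin (q + 1) =>
        coeffInt g ((m : ℤ) + k - (if (i : ℕ) < q then (i : ℕ) else q + r : ℕ))) := by
  let H : Matrix (Fin (m + q + 1)) (Fin (m + q + 1)) R :=
    Matrix.of fun i j => coeffInt g ((j : ℤ) - i)
  have hH : H.det = 1 := by
    rw [Matrix.det_of_isUpperTriangular]
    · refine Finset.prod_eq_one fun i _ => ?_
      simp [H, coeffInt, hg]
    · intro i j hij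
      have hij' : (j : ℕ) < i := hij
      exact coeffInt_of_neg g (by omega)
  have hmul : ∀ i j, (toeplitzUnitRows f m q r * H) i j =
      if (i : ℕ) < m then (if (i : ℕ) = j then 1 else 0)
      else coeffInt g ((j : ℤ) - (if (i : ℕ) < m + q then (i : ℕ) - m else q + r : ℕ)) := by
    intro i j
    rw [Matrix.mul_apply]
    by_cases hi : (i : ℕ) < m
    · rw [if_pos hi, ← coeffInt_one, ← hfg, ← sum_coeffInt_mul_coeffInt f g j.2]
      simp [toeplitzUnitRows, H, hi]
    · rw [if_neg hi]
      have hlt : (if (i : ℕ) < m + q then (i : ℕ) - m else q + r) < m + q + 1 := by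
        split_ifs <;> omega
      rw [Finset.sum_eq_single ⟨_, hlt⟩]
      · simp [toeplitzUnitRows, H, hi]
      · intro k _ hk
        have hk' : ¬ (k : ℕ) = (if (i : ℕ) < m + q then (i : ℕ) - m else q + r) := by
          simpa [Fin.ext_iff] using hk
        simp only [toeplitzUnitRows, Matrix.of_apply, if_neg hi, if_neg hk', zero_mul]
      · simp
  let e : Fin m ⊕ Fin (q + 1) ≃ Fin (m + q + 1) := finSumFinEquiv
  rw [← mul_one (toeplitzUnitRows f m q r).det, ← hH, ← Matrix.det_mul,
    ← Matrix.det_submatrix_equiv_self e, ← Matrix.fromBlocks_toBlocks (Matrix.submatrix _ e e)]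
  have h11 : ((toeplitzUnitRows f m q r * H).submatrix e e).toBlocks₁₁ = 1 := by
    ext i j
    simp [Matrix.toBlocks₁₁, hmul, e, Matrix.one_apply, Fin.ext_iff]
  have h12 : ((toeplitzUnitRows f m q r * H).submatrix e e).toBlocks₁₂ = 0 := by
    ext i j
    simp [Matrix.toBlocks₁₂, hmul, e]
    omega
  rw [h11, h12, Matrix.det_fromBlocks_zero₁₂, Matrix.det_one, one_mul]
  congr 1
  ext i j
  simp [Matrix.toBlocks₂₂, hmul, e]

/-- A cofactor of a banded Toeplitz matrix, expressed through the inverse power series. -/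
theorem adjugate_coeffInt_toeplitz {R : Type*} [CommRing R] {f g : PowerSeries R}
    (hfg : f * g = 1) (hg : PowerSeries.coeff 0 g = 1) {m q : ℕ} (r : Fin (m + 1)) :
    Matrix.adjugate (Matrix.of fun j k : Fin (m + 1) => coeffInt f ((q : ℤ) + 1 - (j - k))) r 0 =
      (-1) ^ ((q + 1) * m) *
      Matrix.det (Matrix.of fun i k : Fin (q + 1) =>
        coeffInt g ((m : ℤ) + k - (if (i : ℕ) < q then (i : ℕ) else q + r : ℕ))) := by
  rw [← det_toeplitzUnitRows hfg hg (Nat.lt_succ_iff.mp r.2), Matrix.adjugate_apply]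
  let ρ : Equiv.Perm (Fin (m + q + 1)) := finRotate (m + q + 1) ^ m
  have hρ : ∀ i, (ρ i : ℕ) = (i + m) % (m + q + 1) := finRotate_pow_val _ _
  have hsign : ((Equiv.Perm.sign ρ : ℤ) : R) = (-1) ^ ((q + 1) * m) := by
    simp only [ρ, map_pow, sign_finRotate]
    push_cast
    rw [← pow_mul, neg_one_pow_congr]
    simp only [Nat.even_mul, Nat.even_add, Nat.even_add_one]
    tauto
  rw [← hsign, ← Matrix.det_permute]
  let e : Fin q ⊕ Fin (m + 1) ≃ Fin (m + q + 1) :=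
    finSumFinEquiv.trans (finCongr (by omega))
  have hel : ∀ i, (e (Sum.inl i) : ℕ) = i := fun i => by simp [e]
  have her : ∀ i, (e (Sum.inr i) : ℕ) = q + i := fun i => by simp [e]
  rw [← Matrix.det_submatrix_equiv_self e, ← Matrix.fromBlocks_toBlocks (Matrix.submatrix _ e e)]
  set Z := ((toeplitzUnitRows f m q r).submatrix ρ id).submatrix e e with hZ
  have hl : ∀ i : Fin q, (ρ (e (Sum.inl i)) : ℕ) = m + i := fun i => by
    rw [hρ, hel, Nat.mod_eq_of_lt (by omega)]; omega
  have hr0 : (ρ (e (Sum.inr 0)) : ℕ) = m + q := by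
    rw [hρ, her, Nat.mod_eq_of_lt (by simp; omega)]; simp; omega
  have hrs : ∀ i : Fin m, (ρ (e (Sum.inr i.succ)) : ℕ) = i := fun i => by
    rw [hρ, her, Fin.val_succ, show q + (i + 1) + m = i + (m + q + 1) by omega,
      Nat.add_mod_right, Nat.mod_eq_of_lt (by omega)]
  have h11 : Z.toBlocks₁₁ = 1 := by
    ext i j
    simp [hZ, Matrix.toBlocks₁₁, toeplitzUnitRows, hl, hel, Matrix.one_apply, Fin.ext_iff, eq_comm]
  have h12 : Z.toBlocks₁₂ = 0 := by
    ext i j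
    simp [hZ, Matrix.toBlocks₁₂, toeplitzUnitRows, hl, her]
    omega
  rw [h11, h12, Matrix.det_fromBlocks_zero₁₂, Matrix.det_one, one_mul]
  congr 1
  ext i j
  refine Fin.cases ?_ (fun i => ?_) i
  · simp [hZ, Matrix.toBlocks₂₂, toeplitzUnitRows, hr0, her, Pi.single_apply, Fin.ext_iff]
  · rw [Matrix.updateRow_ne (Fin.succ_ne_zero i)]
    simp only [hZ, Matrix.toBlocks₂₂, toeplitzUnitRows, Matrix.submatrix_apply, id, Matrix.of_apply,
      hrs, her, Fin.is_lt, if_true, Fin.val_succ]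
    congr 1
    push_cast
    ring

theorem coeff_prod_one_sub {w : ℕ} (z : Fin w → ℂ) (d : ℕ) :
    PowerSeries.coeff d (∏ i, (1 - PowerSeries.C (z i) * PowerSeries.X)) =
      (-1) ^ d * ∑ s ∈ Finset.powersetCard d (Finset.univ : Finset (Fin w)), ∏ i ∈ s, z i := by
  have key : ∀ t : Finset (Fin w), ∏ i ∈ t, -(PowerSeries.C (z i) * PowerSeries.X) =
      PowerSeries.C ((-1) ^ t.card * ∏ i ∈ t, z i) * PowerSeries.X ^ t.card := by
    intro t
    rw [Finset.prod_neg, Finset.prod_mul_distrib, Finset.prod_const]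
    simp [mul_assoc]
  simp only [sub_eq_add_neg, Finset.prod_one_add, key, map_sum, PowerSeries.coeff_C_mul,
    PowerSeries.coeff_X_pow, mul_ite, mul_one, mul_zero]
  rw [← Finset.sum_filter, Finset.mul_sum]
  refine Finset.sum_congr ?_ fun t ht => ?_
  · ext t
    simp [Finset.mem_powersetCard, eq_comm]
  · rw [(Finset.mem_powersetCard.mp ht).2]

theorem coeff_prod_geometric {w : ℕ} (z : Fin w → ℂ) (d : ℕ) :
    PowerSeries.coeff d (∏ i, PowerSeries.mk fun k => z i ^ k) =
      ∑ m : Sym (Fin w) d, (m.1.map z).prod := by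
  rw [PowerSeries.coeff_prod]
  symm
  refine Finset.sum_bij (fun m _ => Multiset.toFinsupp m.1) ?_ ?_ ?_ ?_
  · intro m _
    simp only [Finset.mem_finsuppAntidiag, Multiset.toFinsupp_apply, Finset.subset_univ, and_true]
    exact (Multiset.sum_count_eq_card fun a _ => Finset.mem_univ a).trans m.2
  · intro a _ b _ h
    exact Subtype.ext (Multiset.toFinsupp.injective h)
  · intro l hl
    refine ⟨⟨Finsupp.toMultiset l, ?_⟩, Finset.mem_univ _, by simp⟩
    rw [Finsupp.card_toMultiset, Finsupp.sum_fintype _ _ (by simp)]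
    exact (Finset.mem_finsuppAntidiag.mp hl).1
  · intro m _
    simp only [PowerSeries.coeff_mk, Multiset.toFinsupp_apply]
    rw [Finset.prod_multiset_map_count]
    refine Finset.prod_subset (Finset.subset_univ _) fun i _ hi => ?_
    rw [Multiset.count_eq_zero_of_notMem (by simpa using hi), pow_zero]

theorem prod_one_sub_mul_prod_geometric {w : ℕ} (z : Fin w → ℂ) :
    (∏ i, (1 - PowerSeries.C (z i) * PowerSeries.X)) * ∏ i, PowerSeries.mk (fun k => z i ^ k)
      = 1 := by
  rw [← Finset.prod_mul_distrib]
  refine Finset.prod_eq_one fun i _ => ?_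
  ext (_ | d)
  · simp [sub_mul]
  · simp [sub_mul, mul_assoc, PowerSeries.coeff_succ_X_mul, PowerSeries.coeff_one, pow_succ']

theorem hInt_eq_coeffInt (w : ℕ) (z : Fin w → ℂ) (r : ℤ) :
    hInt w z r = coeffInt (∏ i, PowerSeries.mk fun k => z i ^ k) r := by
  simp only [hInt, coeffInt, coeff_prod_geometric]

theorem aCoeff_eq_coeffInt (w p : ℕ) (ap : ℂ) (z : Fin w → ℂ) (k : ℤ) :
    aCoeff w p ap z k =
      ap * coeffInt (∏ i, (1 - PowerSeries.C (z i) * PowerSeries.X)) ((p : ℤ) - k) := by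
  simp only [aCoeff, eInt, coeffInt, coeff_prod_one_sub]
  split_ifs with h
  · obtain ⟨d, hd⟩ := Int.eq_ofNat_of_zero_le h
    rw [hd]
    simp only [Int.toNat_natCast, zpow_natCast]
    ring
  · simp

/-- Corollary 1 (eq:adj_first_column): the first column of the adjugate,
`adj(T_n(a))_{r,1} = (-1)^{p(n-1)} a_p^{n-1} s_{((n-1)^{p-1}, n-r)}(z_1,…,z_w)`. -/
theorem toeplitz_adjugate_first_column
    (w : ℕ) (hw : 1 ≤ w) (z : Fin w → ℂ) (p : ℕ) (hp : 1 ≤ p) (ap : ℂ) (hap : ap ≠ 0)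
    (n : ℕ) (hn : 1 ≤ n) (r : ℕ) (hr : 1 ≤ r) (hrn : r ≤ n) :
    Matrix.adjugate (toeplitz n (aCoeff w p ap z)) ⟨r - 1, by omega⟩ ⟨0, by omega⟩
      = (-1 : ℂ) ^ (p * (n - 1)) * ap ^ (n - 1)
        * schur w z p
            (fun j => if j ≤ p - 1 then (n : ℤ) - 1 else (n : ℤ) - (r : ℤ)) := by
  obtain ⟨m, rfl⟩ := Nat.exists_eq_add_of_le' hn
  obtain ⟨q, rfl⟩ := Nat.exists_eq_add_of_le' hp
  obtain ⟨r, rfl⟩ := Nat.exists_eq_add_of_le' hr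
  have hT : toeplitz (m + 1) (aCoeff w (q + 1) ap z) = ap • Matrix.of fun j k : Fin (m + 1) =>
      coeffInt (∏ i, (1 - PowerSeries.C (z i) * PowerSeries.X)) ((q : ℤ) + 1 - (j - k)) := by
    ext j k
    simp [toeplitz, aCoeff_eq_coeffInt]
  have hg : PowerSeries.coeff 0 (∏ i, PowerSeries.mk fun k => z i ^ k) = 1 := by
    simp [map_prod, ← PowerSeries.coeff_zero_eq_constantCoeff_apply]
  have key := adjugate_coeffInt_toeplitz (prod_one_sub_mul_prod_geometric z) hg (q := q)
    (⟨r, by omega⟩ : Fin (m + 1))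
  have hS : schur w z (q + 1)
      (fun j => if j ≤ q + 1 - 1 then ((m + 1 : ℕ) : ℤ) - 1 else ((m + 1 : ℕ) : ℤ) - (r + 1 : ℕ)) =
      Matrix.det (Matrix.of fun i k : Fin (q + 1) =>
        coeffInt (∏ i, PowerSeries.mk fun k => z i ^ k)
          ((m : ℤ) + k - (if (i : ℕ) < q then (i : ℕ) else q + r : ℕ))) := by
    unfold schur skewSchur
    congr 1
    ext i k
    simp only [Matrix.of_apply, hInt_eq_coeffInt]
    congr 1
    have := i.2
    split_ifs <;> push_cast <;> omega
  rw [hT, hS, Matrix.adjugate_smul]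
  simp only [Matrix.smul_apply, smul_eq_mul, Fintype.card_fin, Nat.add_sub_cancel]
  refine (congrArg (ap ^ m * ·) key).trans ?_
  ring
end
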